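/- There exists a constant C > 0 such that for every n ≥ 5 and every simple graph G on n vertices with independence number at most 2, t₄(G)/C(n,4) ≥ 3/25 + (1/30)·N(G₅;G)/C(n,5) + (2/15)·N(C₄;G)/C(n,4) − C/n, where N(C₄;G) is the number of 4-element vertex subsets of G inducing a 4-cycle, and N(G₅;G) is the number of 5-element vertex subsets of G inducing the graph G₅ on {1,...,5} with edge set {13,15,24,25,34,35,45}. -/

import Mathlib

/-- `G` has no independent set with more than `m` vertices, i.e. α(G) ≤ m. -/
def IndepBound {V : Type*} (G : SimpleGraph V) (m : ℕ) : Prop :=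
  ∀ s : Finset V, (∀ u ∈ s, ∀ v ∈ s, u ≠ v → ¬ G.Adj u v) → s.card ≤ m

/-- the number of `k`-cliques of `G`. -/
noncomputable def cliqueCount {V : Type*} [Fintype V] (G : SimpleGraph V) (k : ℕ) : ℕ :=
  Nat.card {s : Finset V // s.card = k ∧ G.IsClique (s : Set V)}

/-- the number of vertex subsets of `G` whose induced subgraph is isomorphic to `H`. -/
noncomputable def copyCount {V W : Type*} [Fintype V] [Fintype W]
    (H : SimpleGraph W) (G : SimpleGraph V) : ℕ :=
  Nat.card {s : Finset V // Nonempty (H ≃g G.induce (s : Set V))}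

/-- The 5-vertex graph G₅ on {1,…,5} with edges {13,15,24,25,34,35,45}
(here on {0,…,4} with edges {02,04,13,14,23,24,34}). -/
def graphG5 : SimpleGraph (Fin 5) :=
  SimpleGraph.fromRel (fun a b =>
    ((a, b) : Fin 5 × Fin 5) ∈
      [((0 : Fin 5), (2 : Fin 5)), (0, 4), (1, 3), (1, 4), (2, 3), (2, 4), (3, 4)])

/-- The 4-cycle C₄. -/
def cycle4 : SimpleGraph (Fin 4) :=
  SimpleGraph.fromRel (fun a b => b = a + 1)

/-- The entry `(i, j)` of a table, zero outside the table. -/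
def lookup (Q : List (List ℤ)) (i j : ℕ) : ℤ := (Q.getD i []).getD j 0

/-- The Gram matrix for three-vertex flags rooted at a vertex. -/
def gramVertex : List (List ℤ) :=
  [[464, 24, -384, -528, 616], [24, 284, -224, -26, 92], [-384, -224, 482, 427, -552],
   [-528, -26, 427, 1034, -1558], [616, 92, -552, -1558, 2544]]

/-- The Gram matrix for four-vertex flags rooted at three independent vertices. -/
def gramEmpty : List (List ℤ) :=
  [[64, 0, 0, -32, 0, -32, -32, -96], [0, 152, 152, -152, 152, -152, -152, 0],
   [0, 152, 152, -152, 152, -152, -152, 0], [-32, -152, -152, 168, -152, 168, 168, 48],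
   [0, 152, 152, -152, 152, -152, -152, 0], [-32, -152, -152, 168, -152, 168, 168, 48],
   [-32, -152, -152, 168, -152, 168, 168, 48], [-96, 0, 0, 48, 0, 48, 48, 144]]

/-- The Gram matrix for four-vertex flags rooted at an edge and an isolated vertex. -/
def gramEdge : List (List ℤ) :=
  [[1248, -480, 288, -912, 288, -912], [-480, 2328, -312, 528, -288, 552],
   [288, -312, 4608, 4104, -4248, -4752], [-912, 528, 4104, 5208, -4752, -3648],
   [288, -288, -4248, -4752, 4608, 4104], [-912, 552, -4752, -3648, 4104, 5208]]

/-- The index of the flag formed by a root and an unordered pair of vertices: `a` and `b` are the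
adjacencies to the root, `e` the adjacency inside the pair. -/
def cherryFlag (a b e : Bool) : ℕ :=
  bif a && b then 4 else bif a || b then cond e 3 2 else cond e 1 0

/-- The index of the flag formed by three roots and a vertex with adjacencies `a`, `b`, `c`. -/
def triFlag (a b c : Bool) : ℕ :=
  cond a (cond b (cond c 7 6) (cond c 5 4)) (cond b (cond c 3 2) (cond c 1 0))

/-- The weight of a labelled graph on five vertices: the scaled difference of the two sides of the
inequality, minus the quadratic forms in the flags. -/
def localWeight (b01 b02 b03 b04 b12 b13 b14 b23 b24 b34 : Bool) : ℤ :=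
  cond (b01 || b02 || b03 || b12 || b13 || b23) 0 600 - 72
  - cond (b01 && b12 && b23 && !b02 && !b03 && !b13 && !b04 && !b14 && !b24 && !b34) 1200 0
  - cond (b01 && b23 && !b02 && !b03 && !b12 && !b13) 240 0
  - lookup gramVertex (cherryFlag b01 b02 b12) (cherryFlag b03 b04 b34)
  - cond (b02 || b12) 0
      (lookup (cond b01 gramEdge gramEmpty) (triFlag b03 b13 b23) (triFlag b04 b14 b24))


/-- The weight of the subgraph that `p` induces on the tuple `x 0, …, x 4` of vertices. -/
def pullWeight {V : Type*} (p : V → V → Bool) (x : Fin 5 → V) : ℤ :=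
  localWeight (p (x 0) (x 1)) (p (x 0) (x 2)) (p (x 0) (x 3)) (p (x 0) (x 4)) (p (x 1) (x 2))
    (p (x 1) (x 3)) (p (x 1) (x 4)) (p (x 2) (x 3)) (p (x 2) (x 4)) (p (x 3) (x 4))

/-- The total weight of a five-vertex graph over all orders of its vertices. -/
def symWeight (p : Fin 5 → Fin 5 → Bool) : ℤ := ∑ σ : Equiv.Perm (Fin 5), pullWeight p σ

/-- The graph on five vertices with the given adjacencies. -/
def ofEdges (b01 b02 b03 b04 b12 b13 b14 b23 b24 b34 : Bool) : Fin 5 → Fin 5 → Bool :=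
  ![![false, b01, b02, b03, b04], ![b01, false, b12, b13, b14], ![b02, b12, false, b23, b24],
    ![b03, b13, b23, false, b34], ![b04, b14, b24, b34, false]]

/-- The adjacencies of a five-vertex graph read as a binary number. -/
def edgeCode (p : Fin 5 → Fin 5 → Bool) : ℕ :=
  (p 0 1).toNat + 2 * (p 0 2).toNat + 4 * (p 0 3).toNat + 8 * (p 0 4).toNat + 16 * (p 1 2).toNat
    + 32 * (p 1 3).toNat + 64 * (p 1 4).toNat + 128 * (p 2 3).toNat + 256 * (p 2 4).toNat
    + 512 * (p 3 4).toNat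

def hasTriangle (p : Fin 5 → Fin 5 → Bool) : Bool :=
  [(0, 1, 2), (0, 1, 3), (0, 1, 4), (0, 2, 3), (0, 2, 4), (0, 3, 4), (1, 2, 3), (1, 2, 4),
    (1, 3, 4), (2, 3, 4)].any fun t => p t.1 t.2.1 && p t.1 t.2.2 && p t.2.1 t.2.2

/-- Some transposition of two vertices decreases the code of the graph. -/
def hasSmallerSwap (p : Fin 5 → Fin 5 → Bool) : Bool :=
  [(0, 1), (0, 2), (0, 3), (0, 4), (1, 2), (1, 3), (1, 4), (2, 3), (2, 4), (3, 4)].any fun t =>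
    Nat.blt (edgeCode fun a b => p (Equiv.swap t.1 t.2 a) (Equiv.swap t.1 t.2 b)) (edgeCode p)

/-- Every triangle-free graph whose code is minimal under transpositions has nonnegative weight. -/
theorem symWeight_check : ∀ b01 b02 b03 b04 b12 b13 b14 b23 b24 b34 : Bool,
    (hasTriangle (ofEdges b01 b02 b03 b04 b12 b13 b14 b23 b24 b34) ||
      (hasSmallerSwap (ofEdges b01 b02 b03 b04 b12 b13 b14 b23 b24 b34) ||
        decide (0 ≤ symWeight (ofEdges b01 b02 b03 b04 b12 b13 b14 b23 b24 b34)))) = true := by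
  decide +kernel

theorem symWeight_comp (p : Fin 5 → Fin 5 → Bool) (τ : Equiv.Perm (Fin 5)) :
    symWeight (fun a b => p (τ a) (τ b)) = symWeight p :=
  Equiv.sum_comp (Equiv.mulLeft τ) fun σ => pullWeight p σ

theorem eq_ofEdges {p : Fin 5 → Fin 5 → Bool} (hs : ∀ a b, p a b = p b a)
    (hi : ∀ a, p a a = false) :
    p = ofEdges (p 0 1) (p 0 2) (p 0 3) (p 0 4) (p 1 2) (p 1 3) (p 1 4) (p 2 3) (p 2 4) (p 3 4) := by
  funext a b
  fin_cases a <;> fin_cases b <;> first | exact hi _ | rfl | exact hs _ _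

theorem symWeight_nonneg {p : Fin 5 → Fin 5 → Bool} (hs : ∀ a b, p a b = p b a)
    (hi : ∀ a, p a a = false) (ht : ∀ a b c, ¬ (p a b ∧ p a c ∧ p b c)) :
    0 ≤ symWeight p := by
  obtain ⟨σ, hσ⟩ := Finite.exists_min
    fun σ : Equiv.Perm (Fin 5) => edgeCode fun a b => p (σ a) (σ b)
  rw [← symWeight_comp p σ]
  set q : Fin 5 → Fin 5 → Bool := fun a b => p (σ a) (σ b) with hq
  have hcheck := symWeight_check (q 0 1) (q 0 2) (q 0 3) (q 0 4) (q 1 2) (q 1 3) (q 1 4) (q 2 3)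
    (q 2 4) (q 3 4)
  rw [← eq_ofEdges (p := q) (fun a b => hs _ _) (fun a => hi _), Bool.or_eq_true, Bool.or_eq_true,
    decide_eq_true_eq] at hcheck
  rcases hcheck with h | h | h
  · obtain ⟨t, -, h⟩ := List.any_eq_true.1 h
    simp only [Bool.and_eq_true] at h
    exact absurd ⟨h.1.1, h.1.2, h.2⟩ (ht _ _ _)
  · obtain ⟨t, -, h⟩ := List.any_eq_true.1 h
    have hlt : edgeCode (fun a b => q (Equiv.swap t.1 t.2 a) (Equiv.swap t.1 t.2 b)) < edgeCode q := by
      simpa [Nat.blt_eq] using h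
    exact absurd (hσ (σ * Equiv.swap t.1 t.2)) (not_le.2 hlt)
  · exact h

section Sums

variable {V : Type*} [Fintype V]

/-- Averaging over all vertex orders, the total weight of a triangle-free graph is nonnegative. -/
theorem sum_pullWeight_nonneg {A : V → V → Bool} (hs : ∀ a b, A a b = A b a)
    (hi : ∀ a, A a a = false) (ht : ∀ a b c, ¬ (A a b ∧ A a c ∧ A b c)) :
    0 ≤ ∑ x : Fin 5 → V, pullWeight A x := by
  have hperm (σ : Equiv.Perm (Fin 5)) :
      ∑ x : Fin 5 → V, pullWeight A (x ∘ σ) = ∑ x : Fin 5 → V, pullWeight A x :=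
    (σ.symm.arrowCongr (Equiv.refl V)).sum_comp (fun x => pullWeight A x)
  have hsum : ∑ σ : Equiv.Perm (Fin 5), ∑ x : Fin 5 → V, pullWeight A (x ∘ σ)
      = 120 * ∑ x : Fin 5 → V, pullWeight A x := by
    simp [hperm, Fintype.card_perm, Nat.factorial]
  have hnonneg : 0 ≤ ∑ σ : Equiv.Perm (Fin 5), ∑ x : Fin 5 → V, pullWeight A (x ∘ σ) := by
    rw [Finset.sum_comm]
    exact Finset.sum_nonneg fun x _ => symWeight_nonneg (p := fun a b => A (x a) (x b))
      (fun _ _ => hs _ _) (fun _ => hi _) (fun _ _ _ => ht _ _ _)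
  linarith

def tupleEquiv (V : Type*) : V × V × V × V × V ≃ (Fin 5 → V) where
  toFun t := ![t.1, t.2.1, t.2.2.1, t.2.2.2.1, t.2.2.2.2]
  invFun x := (x 0, x 1, x 2, x 3, x 4)
  left_inv _ := rfl
  right_inv x := by funext i; fin_cases i <;> rfl

theorem sum_tuple (f : (Fin 5 → V) → ℤ) :
    ∑ x, f x = ∑ a, ∑ b, ∑ c, ∑ d, ∑ e, f ![a, b, c, d, e] := by
  rw [← (tupleEquiv V).sum_comp]
  simp only [Fintype.sum_prod_type]
  rfl

/-- `Q` restricted to indices below `m` is positive semidefinite, as witnessed by a weighted sum of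
squares of linear forms. -/
def IsGram (Q : List (List ℤ)) (m : ℕ) : Prop :=
  ∃ D : ℤ, 0 < D ∧ ∃ L : List (ℕ × List ℤ), ∀ i < m, ∀ j < m,
    D * lookup Q i j = (L.map fun w => (w.1 : ℤ) * (w.2.getD i 0 * w.2.getD j 0)).sum

theorem IsGram.sum_nonneg {Q : List (List ℤ)} {m : ℕ} (hQ : IsGram Q m) {ι : Type*} [Fintype ι]
    (φ : ι → ℕ) (hφ : ∀ u, φ u < m) : 0 ≤ ∑ u, ∑ v, lookup Q (φ u) (φ v) := by
  obtain ⟨D, hD, L, hL⟩ := hQ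
  refine nonneg_of_mul_nonneg_right (b := ∑ u, ∑ v, lookup Q (φ u) (φ v)) ?_ hD
  simp only [Finset.mul_sum, hL _ (hφ _) _ (hφ _)]
  clear hL
  induction L with
  | nil => simp
  | cons w L ih =>
    simp only [List.map_cons, List.sum_cons, Finset.sum_add_distrib]
    refine add_nonneg ?_ ih
    simp only [← Finset.mul_sum, ← Finset.sum_mul]
    exact mul_nonneg (Int.natCast_nonneg _) (mul_self_nonneg _)

theorem isGram_vertex : IsGram gramVertex 5 :=
  ⟨16363590369942, by norm_num,
    [(230473103802, [12, 142, -112, -13, 46]), (10631659, [-25920, 0, 21678, 28861, -34040]),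
      (71, [-862056, 0, 0, 10631659, -19754720]), (22744562542584, [-4, 0, 0, 0, 7])],
    by decide +kernel⟩

theorem isGram_empty : IsGram gramEmpty 8 :=
  ⟨21, by norm_num, [(8, [-4, -19, -19, 21, -19, 21, 21, 6]), (304, [-2, 1, 1, 0, 1, 0, 0, 3])],
    by decide +kernel⟩

theorem isGram_edge : IsGram gramEdge 8 :=
  ⟨52529865, by norm_num,
    [(12997080, [-20, 97, -13, 22, -12, 23]), (632, [-3246, 0, 16873, 20565, -18942, -15250]),
      (14938, [-1896, 0, -1637, 0, 948, 2585]), (19901504550, [0, 0, -1, 0, 0, 1])],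
    by decide +kernel⟩

theorem cherryFlag_lt (a b e : Bool) : cherryFlag a b e < 5 := by revert a b e; decide

theorem triFlag_lt (a b c : Bool) : triFlag a b c < 8 := by revert a b c; decide

/-- The number of ordered independent quadruples. -/
def indepSum (A : V → V → Bool) : ℤ :=
  ∑ a, ∑ b, ∑ c, ∑ d, cond (A a b || A a c || A a d || A b c || A b d || A c d) 0 1

/-- The number of ordered quadruples inducing exactly the matching `ab`, `cd`. -/
def matchingSum (A : V → V → Bool) : ℤ :=
  ∑ a, ∑ b, ∑ c, ∑ d, cond (A a b && A c d && !A a c && !A a d && !A b c && !A b d) 1 0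

/-- The number of ordered quintuples inducing exactly the path `abcd` and the isolated vertex `e`. -/
def pathSum (A : V → V → Bool) : ℤ :=
  ∑ a, ∑ b, ∑ c, ∑ d, ∑ e, cond (A a b && A b c && A c d && !A a c && !A a d && !A b d && !A a e
    && !A b e && !A c e && !A d e) 1 0

theorem flag_inequality {A : V → V → Bool} (hs : ∀ a b, A a b = A b a)
    (hi : ∀ a, A a a = false) (ht : ∀ a b c, ¬ (A a b ∧ A a c ∧ A b c)) :
    72 * (Fintype.card V : ℤ) ^ 5 + 1200 * pathSum A + 240 * Fintype.card V * matchingSum A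
      ≤ 600 * Fintype.card V * indepSum A := by
  have htotal := sum_pullWeight_nonneg hs hi ht
  rw [sum_tuple] at htotal
  have hcherry : 0 ≤ ∑ a, ∑ b, ∑ c, ∑ d, ∑ e, lookup gramVertex
      (cherryFlag (A a b) (A a c) (A b c)) (cherryFlag (A a d) (A a e) (A d e)) := by
    refine Finset.sum_nonneg fun a _ => ?_
    have := isGram_vertex.sum_nonneg (fun t : V × V => cherryFlag (A a t.1) (A a t.2) (A t.1 t.2))
      (fun _ => cherryFlag_lt _ _ _)
    simpa only [Fintype.sum_prod_type] using this
  have htri : 0 ≤ ∑ a, ∑ b, ∑ c, ∑ d, ∑ e, cond (A a c || A b c) 0 (lookup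
      (cond (A a b) gramEdge gramEmpty) (triFlag (A a d) (A b d) (A c d))
      (triFlag (A a e) (A b e) (A c e))) := by
    refine Finset.sum_nonneg fun a _ => Finset.sum_nonneg fun b _ => Finset.sum_nonneg fun c _ => ?_
    cases A a c || A b c
    · cases A a b
      · exact isGram_empty.sum_nonneg (fun d => triFlag (A a d) (A b d) (A c d))
          (fun _ => triFlag_lt _ _ _)
      · exact isGram_edge.sum_nonneg (fun d => triFlag (A a d) (A b d) (A c d))
          (fun _ => triFlag_lt _ _ _)
    · simp
  have hsplit (a b c d e : V) : pullWeight A ![a, b, c, d, e] =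
      600 * cond (A a b || A a c || A a d || A b c || A b d || A c d) 0 1 - 72
      - 1200 * cond (A a b && A b c && A c d && !A a c && !A a d && !A b d && !A a e
          && !A b e && !A c e && !A d e) 1 0
      - 240 * cond (A a b && A c d && !A a c && !A a d && !A b c && !A b d) 1 0
      - lookup gramVertex (cherryFlag (A a b) (A a c) (A b c)) (cherryFlag (A a d) (A a e) (A d e))
      - cond (A a c || A b c) 0 (lookup (cond (A a b) gramEdge gramEmpty)
          (triFlag (A a d) (A b d) (A c d)) (triFlag (A a e) (A b e) (A c e))) := by
    simp only [pullWeight, localWeight, Bool.apply_cond (fun z : ℤ => 600 * z),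
      Bool.apply_cond (fun z : ℤ => 1200 * z), Bool.apply_cond (fun z : ℤ => 240 * z)]
    rfl
  simp only [hsplit, Finset.sum_sub_distrib, ← Finset.mul_sum, Finset.sum_const, Finset.card_univ,
    nsmul_eq_mul] at htotal
  simp only [indepSum, matchingSum, pathSum]
  linarith

end Sums

section Counting

variable {V W : Type*}

instance [Finite V] [Finite W] (H : SimpleGraph W) (G : SimpleGraph V) : Finite (H ↪g G) :=
  DFunLike.finite _

instance [Finite V] [Finite W] (H : SimpleGraph W) (G : SimpleGraph V) : Finite (H ≃g G) :=
  DFunLike.finite _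

open Classical in
/-- The adjacency relation of the complement of `G`. -/
noncomputable def nonAdj (G : SimpleGraph V) (u v : V) : Bool := decide (u ≠ v ∧ ¬ G.Adj u v)

theorem nonAdj_eq_true {G : SimpleGraph V} {u v : V} :
    nonAdj G u v = true ↔ u ≠ v ∧ ¬ G.Adj u v := by
  simp [nonAdj]

theorem nonAdj_embedding {H : SimpleGraph W} {G : SimpleGraph V} (f : H ↪g G) (u v : W) :
    nonAdj G (f u) (f v) = nonAdj H u v := by
  rw [Bool.eq_iff_iff, nonAdj_eq_true, nonAdj_eq_true, f.map_adj_iff, f.injective.ne_iff]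

variable [Fintype V] [Fintype W]

theorem card_embedding (H : SimpleGraph W) (G : SimpleGraph V) :
    Nat.card (H ↪g G) = copyCount H G * Nat.card (H ≃g H) := by
  rw [copyCount, ← Nat.card_prod]
  let c (s : {s : Finset V // Nonempty (H ≃g G.induce (s : Set V))}) :
      H ≃g G.induce (s.1 : Set V) := s.2.some
  refine (Nat.card_congr (Equiv.ofBijective (fun t =>
    (SimpleGraph.Embedding.induce (G := G) (t.1.1 : Set V)).comp
      ((c t.1).toEmbedding.comp t.2.toEmbedding)) ⟨?_, ?_⟩)).symm
  · rintro ⟨s, φ⟩ ⟨t, ψ⟩ h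
    have happ (w : W) : (c s (φ w) : V) = c t (ψ w) := DFunLike.congr_fun h w
    have hst : s = t := by
      ext v
      constructor
      · intro hv
        obtain ⟨w, hw⟩ := φ.surjective ((c s).symm ⟨v, hv⟩)
        have := happ w
        rw [hw, RelIso.apply_symm_apply] at this
        exact (show v = _ from this) ▸ (c t (ψ w)).2
      · intro hv
        obtain ⟨w, hw⟩ := ψ.surjective ((c t).symm ⟨v, hv⟩)
        have := happ w
        rw [hw, RelIso.apply_symm_apply] at this
        exact (show _ = v from this) ▸ (c s (φ w)).2
    subst hst
    have : φ = ψ := by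
      ext w
      exact (c s).injective (Subtype.ext (happ w))
    rw [this]
  · intro f
    have hrange : Set.range f = ((Finset.univ.map f.toEmbedding : Finset V) : Set V) := by
      ext; simp
    obtain ⟨e, he⟩ : ∃ e : H ≃g G.induce ((Finset.univ.map f.toEmbedding : Finset V) : Set V),
        ∀ w, (e w : V) = f w := by
      rw [← hrange]
      exact ⟨f.isoInduceRange, fun _ => rfl⟩
    refine ⟨(⟨_, ⟨e⟩⟩, e.trans (c ⟨_, ⟨e⟩⟩).symm), ?_⟩
    ext w
    change ((c ⟨_, ⟨e⟩⟩ ((c ⟨_, ⟨e⟩⟩).symm (e w)) : _) : V) = f w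
    rw [RelIso.apply_symm_apply, he]

theorem cliqueCount_eq_copyCount (G : SimpleGraph V) (k : ℕ) :
    cliqueCount G k = copyCount (⊤ : SimpleGraph (Fin k)) G := by
  refine Nat.card_congr (Equiv.subtypeEquivRight fun s => ?_)
  rw [← SimpleGraph.induce_eq_top]
  constructor
  · rintro ⟨hs, h⟩
    rw [h]
    exact ⟨SimpleGraph.Iso.completeGraph (Fintype.equivFinOfCardEq (by simpa using hs)).symm⟩
  · rintro ⟨e⟩
    refine ⟨by simpa using (Fintype.card_congr e.toEquiv).symm, ?_⟩
    ext u v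
    rw [← e.symm.map_adj_iff]
    simp

theorem copyCount_le_choose {k : ℕ} (H : SimpleGraph (Fin k)) (G : SimpleGraph V) :
    copyCount H G ≤ (Fintype.card V).choose k := by
  rw [← Fintype.card_finset_len, ← Nat.card_eq_fintype_card]
  refine Nat.card_mono (Set.toFinite _) ?_
  rintro s ⟨e⟩
  change s.card = k
  simpa using (Fintype.card_congr e.toEquiv).symm

theorem card_aut_complete_le : Nat.card ((⊤ : SimpleGraph (Fin 4)) ≃g (⊤ : SimpleGraph (Fin 4))) ≤ 24 := by
  have h := Nat.card_le_card_of_injective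
    (fun e : (⊤ : SimpleGraph (Fin 4)) ≃g (⊤ : SimpleGraph (Fin 4)) => (e.toEquiv : Equiv.Perm (Fin 4)))
    RelIso.toEquiv_injective
  simpa [Nat.card_eq_fintype_card, Fintype.card_perm, Nat.factorial] using h

theorem two_le_card_aut_graphG5 : 2 ≤ Nat.card (graphG5 ≃g graphG5) := by
  let σ : Equiv.Perm (Fin 5) := Equiv.swap 0 1 * Equiv.swap 2 3
  have hadj : ∀ a b : Fin 5, graphG5.Adj (σ a) (σ b) ↔ graphG5.Adj a b := by
    simp only [graphG5, SimpleGraph.fromRel_adj]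
    decide
  have hne : σ 0 ≠ 0 := by decide
  have : Nontrivial (graphG5 ≃g graphG5) :=
    ⟨⟨⟨σ, hadj _ _⟩, RelIso.refl _, fun h => hne (DFunLike.congr_fun h (0 : Fin 5))⟩⟩
  exact Finite.one_lt_card

theorem eight_le_card_aut_cycle4 : 8 ≤ Nat.card (cycle4 ≃g cycle4) := by
  have hadd : ∀ c a b : Fin 4, cycle4.Adj (c + a) (c + b) ↔ cycle4.Adj a b := by
    simp only [cycle4, SimpleGraph.fromRel_adj]
    decide
  have hsub : ∀ c a b : Fin 4, cycle4.Adj (c - a) (c - b) ↔ cycle4.Adj a b := by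
    simp only [cycle4, SimpleGraph.fromRel_adj]
    decide
  let F : Bool × Fin 4 → (cycle4 ≃g cycle4)
    | (true, c) => ⟨Equiv.addLeft c, hadd c _ _⟩
    | (false, c) => ⟨Equiv.subLeft c, hsub c _ _⟩
  have hF : Function.Injective F := by
    have key : ∀ s t : Bool × Fin 4, (∀ i : Fin 4, (bif s.1 then s.2 + i else s.2 - i) =
        bif t.1 then t.2 + i else t.2 - i) → s = t := by decide
    intro s t h
    refine key s t fun i => ?_
    have := DFunLike.congr_fun h i
    rcases s with ⟨_ | _, _⟩ <;> rcases t with ⟨_ | _, _⟩ <;> exact this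
  simpa using Nat.card_le_card_of_injective F hF

theorem sum_cond_eq_card {T : Type*} [Fintype T] (P : T → Bool) :
    ∑ t, cond (P t) (1 : ℤ) 0 = Nat.card {t // P t = true} := by
  simp [Nat.card_eq_fintype_card, Fintype.card_subtype, Bool.cond_eq_ite]

theorem card_graphG5_le_pathSum (G : SimpleGraph V) :
    (Nat.card (graphG5 ↪g G) : ℤ) ≤ pathSum (nonAdj G) := by
  have h := sum_cond_eq_card fun t : V × V × V × V × V =>
    nonAdj G t.1 t.2.1 && nonAdj G t.2.1 t.2.2.1 && nonAdj G t.2.2.1 t.2.2.2.1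
    && !nonAdj G t.1 t.2.2.1 && !nonAdj G t.1 t.2.2.2.1 && !nonAdj G t.2.1 t.2.2.2.1
    && !nonAdj G t.1 t.2.2.2.2 && !nonAdj G t.2.1 t.2.2.2.2 && !nonAdj G t.2.2.1 t.2.2.2.2
    && !nonAdj G t.2.2.2.1 t.2.2.2.2
  simp only [Fintype.sum_prod_type] at h
  rw [pathSum, h, Nat.cast_le]
  refine Nat.card_le_card_of_injective (fun f => ⟨(f 3, f 0, f 1, f 2, f 4), ?_⟩) ?_
  · simp only [nonAdj_embedding]
    simp [nonAdj, graphG5]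
  · intro f g hfg
    simp only [Subtype.mk.injEq, Prod.mk.injEq] at hfg
    ext i
    fin_cases i <;> simp [hfg]

theorem card_cycle4_le_matchingSum (G : SimpleGraph V) :
    (Nat.card (cycle4 ↪g G) : ℤ) ≤ matchingSum (nonAdj G) := by
  have h := sum_cond_eq_card fun t : V × V × V × V =>
    nonAdj G t.1 t.2.1 && nonAdj G t.2.2.1 t.2.2.2 && !nonAdj G t.1 t.2.2.1
    && !nonAdj G t.1 t.2.2.2 && !nonAdj G t.2.1 t.2.2.1 && !nonAdj G t.2.1 t.2.2.2
  simp only [Fintype.sum_prod_type] at h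
  rw [matchingSum, h, Nat.cast_le]
  refine Nat.card_le_card_of_injective (fun f => ⟨(f 0, f 2, f 1, f 3), ?_⟩) ?_
  · simp only [nonAdj_embedding]
    simp [nonAdj, cycle4]
  · intro f g hfg
    simp only [Subtype.mk.injEq, Prod.mk.injEq] at hfg
    ext i
    fin_cases i <;> simp [hfg]

open Classical in
theorem indepSum_le (G : SimpleGraph V) :
    indepSum (nonAdj G) ≤ Nat.card ((⊤ : SimpleGraph (Fin 4)) ↪g G) + 6 * Fintype.card V ^ 3 := by
  let P (a b c d : V) : Bool := decide (G.Adj a b ∧ G.Adj a c ∧ G.Adj a d ∧ G.Adj b c ∧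
    G.Adj b d ∧ G.Adj c d)
  let δ (a b : V) : ℤ := if a = b then 1 else 0
  have hδ (a b : V) : 0 ≤ δ a b := by simp only [δ]; split_ifs <;> simp
  have hpoint (a b c d : V) : cond (nonAdj G a b || nonAdj G a c || nonAdj G a d || nonAdj G b c
      || nonAdj G b d || nonAdj G c d) (0 : ℤ) 1 ≤
      cond (P a b c d) 1 0 + (δ a b + δ a c + δ a d + δ b c + δ b d + δ c d) := by
    have := hδ a b; have := hδ a c; have := hδ a d; have := hδ b c; have := hδ b d
    have := hδ c d
    by_cases hne : a ≠ b ∧ a ≠ c ∧ a ≠ d ∧ b ≠ c ∧ b ≠ d ∧ c ≠ d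
    · obtain ⟨h1, h2, h3, h4, h5, h6⟩ := hne
      have hP : cond (nonAdj G a b || nonAdj G a c || nonAdj G a d || nonAdj G b c
          || nonAdj G b d || nonAdj G c d) (0 : ℤ) 1 = cond (P a b c d) 1 0 := by
        rw [show (0 : ℤ) = cond false 1 0 from rfl]
        by_cases hadj : P a b c d = true
        · have := of_decide_eq_true hadj
          simp [hadj, nonAdj, this]
        · have h' := hadj
          simp only [P, decide_eq_true_eq] at h'
          have hor : (nonAdj G a b || nonAdj G a c || nonAdj G a d || nonAdj G b c
              || nonAdj G b d || nonAdj G c d) = true := by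
            simp only [Bool.or_eq_true, nonAdj_eq_true]
            tauto
          rw [hor, Bool.eq_false_of_not_eq_true hadj]
          rfl
      linarith
    · have hone : 1 ≤ δ a b + δ a c + δ a d + δ b c + δ b d + δ c d := by
        have hself (x y : V) (h : x = y) : δ x y = 1 := if_pos h
        by_contra hlt
        refine hne ⟨?_, ?_, ?_, ?_, ?_, ?_⟩ <;> intro h <;> have := hself _ _ h <;> linarith
      have hle : cond (nonAdj G a b || nonAdj G a c || nonAdj G a d || nonAdj G b c
          || nonAdj G b d || nonAdj G c d) (0 : ℤ) 1 ≤ 1 := by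
        cases (nonAdj G a b || nonAdj G a c || nonAdj G a d || nonAdj G b c
          || nonAdj G b d || nonAdj G c d) <;> simp
      have hP : 0 ≤ cond (P a b c d) (1 : ℤ) 0 := by cases P a b c d <;> simp
      linarith
  have hcard : ∑ a, ∑ b, ∑ c, ∑ d, cond (P a b c d) (1 : ℤ) 0
      ≤ Nat.card ((⊤ : SimpleGraph (Fin 4)) ↪g G) := by
    have h := sum_cond_eq_card fun t : V × V × V × V => P t.1 t.2.1 t.2.2.1 t.2.2.2
    simp only [Fintype.sum_prod_type] at h
    rw [h, Nat.cast_le]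
    have hadj (t : {t : V × V × V × V // P t.1 t.2.1 t.2.2.1 t.2.2.2 = true}) (i j : Fin 4)
        (hij : i ≠ j) :
        G.Adj (![t.1.1, t.1.2.1, t.1.2.2.1, t.1.2.2.2] i)
          (![t.1.1, t.1.2.1, t.1.2.2.1, t.1.2.2.2] j) := by
      obtain ⟨h1, h2, h3, h4, h5, h6⟩ := of_decide_eq_true t.2
      fin_cases i <;> fin_cases j <;>
        first | exact absurd rfl hij | assumption | (apply SimpleGraph.Adj.symm; assumption)
    refine Nat.card_le_card_of_injective (fun t => ⟨⟨![t.1.1, t.1.2.1, t.1.2.2.1, t.1.2.2.2],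
      fun i j hij => by_contra fun hne => (hadj t i j hne).ne hij⟩, fun {i j} =>
      ⟨fun h => fun hij => h.ne (by rw [hij]), fun h => hadj t i j h⟩⟩) ?_
    intro s t hst
    have happ (i : Fin 4) := DFunLike.congr_fun hst i
    refine Subtype.ext ?_
    exact Prod.ext (happ 0) (Prod.ext (happ 1) (Prod.ext (happ 2) (happ 3)))
  have hdiag : ∑ a, ∑ b, ∑ c, ∑ d, (δ a b + δ a c + δ a d + δ b c + δ b d + δ c d)
      = 6 * (Fintype.card V : ℤ) ^ 3 := by
    simp only [δ, Finset.sum_add_distrib, Finset.sum_ite_eq, Finset.sum_const, Finset.mem_univ,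
      if_true, Finset.card_univ, nsmul_eq_mul, ← Finset.mul_sum]
    ring
  calc indepSum (nonAdj G) ≤ ∑ a, ∑ b, ∑ c, ∑ d, (cond (P a b c d) (1 : ℤ) 0
        + (δ a b + δ a c + δ a d + δ b c + δ b d + δ c d)) :=
      Finset.sum_le_sum fun a _ => Finset.sum_le_sum fun b _ => Finset.sum_le_sum fun c _ =>
        Finset.sum_le_sum fun d _ => hpoint a b c d
    _ = ∑ a, ∑ b, ∑ c, ∑ d, cond (P a b c d) (1 : ℤ) 0 +
        ∑ a, ∑ b, ∑ c, ∑ d, (δ a b + δ a c + δ a d + δ b c + δ b d + δ c d) := by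
      simp only [Finset.sum_add_distrib]
    _ ≤ _ := by rw [hdiag]; exact add_le_add_left hcard _

theorem count_inequality (G : SimpleGraph V) (hG : IndepBound G 2) :
    72 * (Fintype.card V : ℤ) ^ 5 + 2400 * copyCount graphG5 G
      + 1920 * Fintype.card V * copyCount cycle4 G
      ≤ 600 * Fintype.card V * (24 * cliqueCount G 4 + 6 * Fintype.card V ^ 3) := by
  classical
  have hflag := flag_inequality (A := nonAdj G)
    (fun a b => by simp [nonAdj, ne_comm, G.adj_comm]) (fun a => by simp [nonAdj])
    (fun a b c h => by
      simp only [nonAdj_eq_true] at h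
      obtain ⟨⟨hab, hab'⟩, ⟨hac, hac'⟩, hbc, hbc'⟩ := h
      have hcard := hG {a, b, c} (by
        intro u hu v hv _
        simp only [Finset.mem_insert, Finset.mem_singleton] at hu hv
        rcases hu with rfl | rfl | rfl <;> rcases hv with rfl | rfl | rfl <;>
          simp_all [G.adj_comm])
      rw [Finset.card_eq_three.2 ⟨a, b, c, hab, hac, hbc, rfl⟩] at hcard
      omega)
  have hpath := card_graphG5_le_pathSum G
  have hmatching := card_cycle4_le_matchingSum G
  have hindep := indepSum_le G
  rw [card_embedding, Nat.cast_mul] at hpath hmatching hindep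
  rw [← cliqueCount_eq_copyCount] at hindep
  have h1 : (copyCount graphG5 G : ℤ) * 2 ≤ copyCount graphG5 G * Nat.card (graphG5 ≃g graphG5) :=
    mul_le_mul_of_nonneg_left (mod_cast two_le_card_aut_graphG5) (by positivity)
  have h2 : (copyCount cycle4 G : ℤ) * 8 ≤ copyCount cycle4 G * Nat.card (cycle4 ≃g cycle4) :=
    mul_le_mul_of_nonneg_left (mod_cast eight_le_card_aut_cycle4) (by positivity)
  have h3 : (cliqueCount G 4 : ℤ) * Nat.card ((⊤ : SimpleGraph (Fin 4)) ≃g (⊤ : SimpleGraph (Fin 4)))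
      ≤ cliqueCount G 4 * 24 :=
    mul_le_mul_of_nonneg_left (mod_cast card_aut_complete_le) (by positivity)
  have hn : (0 : ℤ) ≤ Fintype.card V := by positivity
  nlinarith [mul_le_mul_of_nonneg_left (h2.trans hmatching) hn,
    mul_le_mul_of_nonneg_left (hindep.trans (add_le_add_left h3 _)) hn]

end Counting

/-- There is C > 0 such that every graph G on n ≥ 5 vertices with α(G) ≤ 2 satisfies
t₄(G)/C(n,4) ≥ 3/25 + (1/30)·N(G₅;G)/C(n,5) + (2/15)·N(C₄;G)/C(n,4) − C/n. -/
theorem erdos_43_flag_inequality :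
    ∃ C : ℝ, 0 < C ∧ ∀ n : ℕ, 5 ≤ n →
      ∀ G : SimpleGraph (Fin n), IndepBound G 2 →
        (cliqueCount G 4 : ℝ) / (n.choose 4) ≥
          3/25 + (1/30) * (copyCount graphG5 G : ℝ) / (n.choose 5)
            + (2/15) * (copyCount cycle4 G : ℝ) / (n.choose 4) - C / n := by
  refine ⟨8, by norm_num, fun n hn G hG => ?_⟩
  have hcount : 72 * (n : ℝ) ^ 5 + 2400 * copyCount graphG5 G + 1920 * n * copyCount cycle4 G
      ≤ 600 * n * (24 * cliqueCount G 4 + 6 * n ^ 3) := by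
    have := count_inequality G hG
    rw [Fintype.card_fin] at this
    exact_mod_cast this
  have h5 : (copyCount graphG5 G : ℝ) ≤ n.choose 5 := by
    exact_mod_cast (Fintype.card_fin n ▸ copyCount_le_choose graphG5 G)
  have h4 : (copyCount cycle4 G : ℝ) ≤ n.choose 4 := by
    exact_mod_cast (Fintype.card_fin n ▸ copyCount_le_choose cycle4 G)
  have hc4 : (24 : ℝ) * n.choose 4 = n * (n - 1) * (n - 2) * (n - 3) := by
    have h := Nat.descFactorial_eq_factorial_mul_choose n 4
    obtain ⟨m, rfl⟩ := Nat.exists_eq_add_of_le' hn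
    have h' : ((24 * (m + 5).choose 4 : ℕ) : ℝ) = ((m + 2) * ((m + 3) * ((m + 4) * (m + 5))) : ℕ) := by
      rw [show 24 = Nat.factorial 4 from rfl, ← h]
      simp [Nat.descFactorial]
    push_cast at h' ⊢
    rw [h']
    ring
  have hc5 : (120 : ℝ) * n.choose 5 = n * (n - 1) * (n - 2) * (n - 3) * (n - 4) := by
    have h := Nat.descFactorial_eq_factorial_mul_choose n 5
    obtain ⟨m, rfl⟩ := Nat.exists_eq_add_of_le' hn
    have h' : ((120 * (m + 5).choose 5 : ℕ) : ℝ) =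
        ((m + 1) * ((m + 2) * ((m + 3) * ((m + 4) * (m + 5)))) : ℕ) := by
      rw [show 120 = Nat.factorial 5 from rfl, ← h]
      simp [Nat.descFactorial]
    push_cast at h' ⊢
    rw [h']
    ring
  have hn5 : (5 : ℝ) ≤ n := by exact_mod_cast hn
  have hpos4 : (0 : ℝ) < n.choose 4 := by exact_mod_cast Nat.choose_pos (by omega)
  have hpos5 : (0 : ℝ) < n.choose 5 := by exact_mod_cast Nat.choose_pos hn
  have hT : 0 ≤ (cliqueCount G 4 : ℝ) / n.choose 4 := by positivity
  have hP : 0 ≤ (copyCount graphG5 G : ℝ) / n.choose 5 := by positivity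
  have hQ : 0 ≤ (copyCount cycle4 G : ℝ) / n.choose 4 := by positivity
  have hP1 := (div_le_one hpos5).2 h5
  have hQ1 := (div_le_one hpos4).2 h4
  rw [mul_div_assoc, mul_div_assoc]
  rw [← div_mul_cancel₀ (cliqueCount G 4 : ℝ) hpos4.ne',
    ← div_mul_cancel₀ (copyCount graphG5 G : ℝ) hpos5.ne',
    ← div_mul_cancel₀ (copyCount cycle4 G : ℝ) hpos4.ne'] at hcount
  generalize (cliqueCount G 4 : ℝ) / n.choose 4 = T at *
  generalize (copyCount graphG5 G : ℝ) / n.choose 5 = P at *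
  generalize (copyCount cycle4 G : ℝ) / n.choose 4 = Q at *
  generalize (n.choose 4 : ℝ) = c4 at *
  generalize (n.choose 5 : ℝ) = c5 at *
  generalize (n : ℝ) = x at *
  have hc4_le : 24 * c4 ≤ x ^ 4 := by
    rw [hc4]; nlinarith [pow_pos (show 0 < x by linarith) 2, pow_pos (show 0 < x by linarith) 3]
  have hc4_ge : x ^ 4 - 6 * x ^ 3 ≤ 24 * c4 := by
    rw [hc4]; nlinarith [pow_pos (show 0 < x by linarith) 2, pow_pos (show 0 < x by linarith) 3]
  have hc5_ge : x ^ 5 - 10 * x ^ 4 ≤ 120 * c5 := by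
    rw [hc5]
    have hx3 : 0 < x ^ 2 * (35 * x - 50) := by
      have : 0 < 35 * x - 50 := by linarith
      positivity
    nlinarith
  have hx : 0 < x := by linarith
  have h1 := mul_le_mul_of_nonneg_left hc4_le (mul_nonneg hx.le hT)
  have h2 := mul_le_mul_of_nonneg_left hc4_ge (mul_nonneg hx.le hQ)
  have h3 := mul_le_mul_of_nonneg_left hc5_ge hP
  have hmain : x ^ 4 * (72 * x + 20 * P * (x - 10) + 80 * Q * (x - 6)) ≤
      x ^ 4 * (600 * (T * x + 6)) := by linarith
  have hdiv := le_of_mul_le_mul_left hmain (pow_pos hx 4)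
  have hgoal : 3 / 25 + 1 / 30 * P + 2 / 15 * Q - T ≤ 8 / x := by
    rw [le_div_iff₀ hx]
    linarith
  linarith
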